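/- Suppose β ∈ [0,1) and p > 1/2. Then there exist a constant C ∈ (0,∞) and a finite subset F ⊂ 𝒟 such that for every configuration S ∈ 𝒟∖F, the one-step expected increment of f₂ for the discrete-time exclusion-voter chain satisfies E_{β,p}[ f₂(ξ_{t+1}) − f₂(ξ_t) | ξ_t = S ] ≤ −C (f₂(S))^{1/6}, i.e. Σ_{S'∈𝒟} P(S,S') f₂(S') − f₂(S) ≤ −C (f₂(S))^{1/6}, where P denotes the one-step transition kernel of the chain. -/

import Mathlib

open MeasureTheory Filter
open scoped ENNReal NNReal

namespace EV

/-- A configuration of the exclusion-voter model is the finite hybrid-zone word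
(`false` = 0, `true` = 1); the full two-sided configuration is `1^∞ w 0^∞`. -/
abbrev Word := List Bool

/-- Canonical (normalized) words: empty (the ground state `𝒟₀`) or starting with
a `0` and ending with a `1`; these are in bijection with the configuration space `𝒟`. -/
def IsConfig (w : Word) : Prop :=
  w = [] ∨ (w.head? = some false ∧ w.getLast? = some true)

/-- The ground-state Heaviside configuration `𝒟₀ = …111000…`. -/
def groundState : Word := []

/-- Pad a word with one boundary symbol of the adjacent infinite block on each side. -/
def pad (w : Word) : Word := true :: (w ++ [false])

/-- Normalize: strip leading `1`s (they merge into the left infinite block of `1`s)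
and trailing `0`s (they merge into the right infinite block of `0`s). -/
def strip (w : Word) : Word :=
  ((w.dropWhile (· = true)).reverse.dropWhile (· = false)).reverse

def setPair (w : Word) (i : ℕ) (a b : Bool) : Word := (w.set i a).set (i + 1) b

def swapPair (w : Word) (i : ℕ) : Word :=
  setPair w i (w.getD (i + 1) true) (w.getD i true)

/-- Indices of the unlike adjacent pairs (`01` or `10`), read off the padded word. -/
def unlike (w : Word) : List ℕ :=
  (List.range (w.length + 1)).filter
    (fun i => (pad w).getD i true ≠ (pad w).getD (i + 1) true)

/-- One-step transition kernel of the discrete-time exclusion-voter chain with mixing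
parameter `β` and exclusion parameter `p`: an unlike adjacent pair is chosen uniformly
at random; with probability `β` a voter move flips the pair to `00` or `11` (each with
probability `1/2`); with probability `1-β` an exclusion move swaps a `01` with
probability `p` and a `10` with probability `1-p` (otherwise no change). -/
noncomputable def P (β p : ℝ) (w w' : Word) : ℝ :=
  ((unlike w).map (fun i =>
    let a := (pad w).getD i true
    let swapProb := if a then 1 - p else p
    ((unlike w).length : ℝ)⁻¹ *
      (β * (1 / 2) * (if strip (setPair (pad w) i false false) = w' then 1 else 0)
       + β * (1 / 2) * (if strip (setPair (pad w) i true true) = w' then 1 else 0)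
       + (1 - β) * swapProb * (if strip (swapPair (pad w) i) = w' then 1 else 0)
       + (1 - β) * (1 - swapProb) * (if w = w' then 1 else 0)))).sum

/-- `n`-step transition probabilities. -/
noncomputable def Pn (β p : ℝ) : ℕ → Word → Word → ℝ
  | 0 => fun w w' => if w = w' then 1 else 0
  | n + 1 => fun w w' => ∑' z : Word, Pn β p n w z * P β p z w'

/-- `w'` is accessible from `w`: some `n`-step transition probability is positive. -/
def Accessible (β p : ℝ) (w w' : Word) : Prop :=
  ∃ n : ℕ, 0 < n ∧ 0 < Pn β p n w w'

/-- Two states communicate: each is accessible from the other. -/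
def Communicate (β p : ℝ) (w w' : Word) : Prop :=
  Accessible β p w w' ∧ Accessible β p w' w

instance : MeasurableSpace Word := ⊤

/-- `ξ` is (a realization of) the discrete-time exclusion-voter Markov chain with
parameters `(β, p)` under the probability measure `μ`. -/
def IsEVChain (β p : ℝ) {Ω : Type*} [MeasurableSpace Ω] (μ : Measure Ω)
    (ξ : ℕ → Ω → Word) : Prop :=
  (∀ t, Measurable (ξ t)) ∧
  ∀ (t : ℕ) (path : ℕ → Word),
    μ {ω | ∀ i ≤ t + 1, ξ i ω = path i}
      = μ {ω | ∀ i ≤ t, ξ i ω = path i} * ENNReal.ofReal (P β p (path t) (path (t + 1)))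

/-- The relaxation time `τ = min {t ∈ ℕ, t ≥ 1 : ξ_t = 𝒟₀}` (`∞` if there is no such `t`). -/
noncomputable def relaxTime {Ω : Type*} (ξ : ℕ → Ω → Word) (ω : Ω) : ℝ≥0∞ :=
  sInf {r : ℝ≥0∞ | ∃ t : ℕ, 0 < t ∧ ξ t ω = groundState ∧ r = (t : ℝ≥0∞)}

/-- The size `|S|` of the hybrid zone. -/
def hz (w : Word) : ℕ := w.length

/-- The number of blocks `N(S)`: the number of (finite) `1`-blocks of the hybrid zone. -/
def nb (w : Word) : ℕ :=
  ((Finset.range w.length).filter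
    (fun b => w.getD b false = true ∧ (b = 0 ∨ w.getD (b - 1) true = false))).card

/-- Number of `0`s among the first `c` positions of the hybrid zone. -/
def z0 (w : Word) (c : ℕ) : ℕ :=
  ((Finset.range c).filter (fun a => w.getD a true = false)).card

/-- Number of `1`s of the hybrid zone at positions `≥ c`. -/
def o1 (w : Word) (c : ℕ) : ℕ :=
  ((Finset.Ico c w.length).filter (fun b => w.getD b false = true)).card

/-- `f₁(S) = Σᵢ mᵢ Rᵢ = Σᵢ nᵢ Tᵢ`: each `1` contributes the number of `0`s to its left. -/
def f1 (w : Word) : ℕ :=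
  ∑ b ∈ (Finset.range w.length).filter (fun b => w.getD b false = true), z0 w b

/-- `f₂(S) = (1/2)(Σᵢ mᵢ Rᵢ² + Σᵢ nᵢ Tᵢ²)`: each `1` contributes the squared number of
`0`s to its left, each `0` the squared number of `1`s to its right. -/
noncomputable def f2 (w : Word) : ℝ :=
  (1 / 2) *
    ((∑ b ∈ (Finset.range w.length).filter (fun b => w.getD b false = true),
        ((z0 w b : ℝ)) ^ 2)
     + (∑ a ∈ (Finset.range w.length).filter (fun a => w.getD a true = false),
        ((o1 w (a + 1) : ℝ)) ^ 2))

/-- `g(S) = max_{1 ≤ k ≤ N} R_k T_k`: the maximum over the `01`-corners of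
(number of `0`s up to the corner) × (number of `1`s after the corner). -/
def gfun (w : Word) : ℕ :=
  ((Finset.range w.length).filter
    (fun a => w.getD a true = false ∧ w.getD (a + 1) false = true)).sup
    (fun a => z0 w (a + 1) * o1 w (a + 1))

/-- `φ₁(S) = Σᵢ Σ_{j=R_{i-1}+1}^{R_i} Σ_{k=1}^{T_i} 1/(j+k)`: the `j`-th `0` (at position `a`,
so `j = z0 w (a+1)`) contributes `Σ_{k=1}^{T} 1/(j+k)` with `T` the number of `1`s to its right. -/
noncomputable def phi1 (w : Word) : ℝ :=
  ∑ a ∈ (Finset.range w.length).filter (fun a => w.getD a true = false),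
    ∑ k ∈ Finset.Icc 1 (o1 w (a + 1)), (1 : ℝ) / ((z0 w (a + 1) : ℝ) + (k : ℝ))


/-- `∑ (R + z)²` over the `1`s of the word, `z` the number of `0`s to the left. -/
def oneEnergy : ℝ → Word → ℝ
  | _, [] => 0
  | R, true :: w => R ^ 2 + oneEnergy R w
  | R, false :: w => oneEnergy (R + 1) w

/-- `∑ (T + o)²` over the `0`s of the word, `o` the number of `1`s to the right. -/
def zeroEnergy (T : ℝ) : Word → ℝ
  | [] => 0
  | true :: w => zeroEnergy T w
  | false :: w => (T + w.count true) ^ 2 + zeroEnergy T w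

lemma oneEnergy_append (R : ℝ) (u v : Word) :
    oneEnergy R (u ++ v) = oneEnergy R u + oneEnergy (R + u.count false) v := by
  induction u generalizing R with
  | nil => simp [oneEnergy]
  | cons a u ih =>
    cases a
    · simp [oneEnergy, ih]; ring_nf
    · simp [oneEnergy, ih]; ring

lemma zeroEnergy_append (T : ℝ) (u v : Word) :
    zeroEnergy T (u ++ v) = zeroEnergy (T + v.count true) u + zeroEnergy T v := by
  induction u with
  | nil => simp [zeroEnergy]
  | cons a u ih =>
    cases a
    · simp [zeroEnergy, ih]; ring
    · simp [zeroEnergy, ih]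

lemma oneEnergy_second_difference (R : ℝ) (w : Word) :
    oneEnergy (R + 2) w + oneEnergy R w = 2 * oneEnergy (R + 1) w + 2 * w.count true := by
  induction w generalizing R with
  | nil => simp [oneEnergy]
  | cons a w ih =>
    cases a
    · have := ih (R + 1)
      simp only [oneEnergy]
      rw [show R + 2 + 1 = R + 1 + 2 by ring, this]
      simp
    · have := ih R
      simp only [oneEnergy, List.count_cons_self]
      push_cast
      linarith

lemma zeroEnergy_second_difference (T : ℝ) (w : Word) :
    zeroEnergy (T + 2) w + zeroEnergy T w = 2 * zeroEnergy (T + 1) w + 2 * w.count false := by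
  induction w with
  | nil => simp [zeroEnergy]
  | cons a w ih =>
    cases a
    · simp only [zeroEnergy, List.count_cons_self]
      push_cast
      linarith
    · simpa [zeroEnergy] using ih

lemma z0_succ_cons (a : Bool) (w : Word) (c : ℕ) :
    z0 (a :: w) (c + 1) = (if a = false then 1 else 0) + z0 w c := by
  simp only [z0, Finset.card_filter, Finset.sum_range_succ']
  simp [add_comm]

lemma o1_cons (a : Bool) (w : Word) (c : ℕ) : o1 (a :: w) (c + 1) = o1 w c := by
  simp only [o1, Finset.card_filter, List.length_cons]
  rw [← Finset.sum_Ico_add' _ c w.length 1]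
  simp

lemma o1_zero (w : Word) : o1 w 0 = w.count true := by
  induction w with
  | nil => simp [o1]
  | cons a w ih =>
    have h : o1 (a :: w) 0 = (if a = true then 1 else 0) + o1 w 0 := by
      simp only [o1, Finset.card_filter, List.length_cons, Nat.Ico_zero_eq_range,
        Finset.sum_range_succ']
      simp [add_comm]
    rw [h, ih]
    cases a <;> simp [add_comm]

lemma sum_ones_eq_oneEnergy (R : ℝ) (w : Word) :
    ∑ b ∈ (Finset.range w.length).filter (fun b => w.getD b false = true),
      (R + z0 w b) ^ 2 = oneEnergy R w := by
  induction w generalizing R with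
  | nil => simp [oneEnergy]
  | cons a w ih =>
    rw [Finset.sum_filter, List.length_cons, Finset.sum_range_succ']
    simp only [z0_succ_cons, List.getD_cons_succ, List.getD_cons_zero]
    rw [← Finset.sum_filter]
    cases a
    · simp only [oneEnergy, ← ih (R + 1)]
      simp [add_assoc]
    · simp only [oneEnergy, ← ih R]
      simp [z0, add_comm]

lemma sum_zeros_eq_zeroEnergy (w : Word) :
    ∑ a ∈ (Finset.range w.length).filter (fun a => w.getD a true = false),
      (o1 w (a + 1) : ℝ) ^ 2 = zeroEnergy 0 w := by
  induction w with
  | nil => simp [zeroEnergy]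
  | cons a w ih =>
    rw [Finset.sum_filter, List.length_cons, Finset.sum_range_succ']
    simp only [o1_cons, List.getD_cons_succ, List.getD_cons_zero]
    rw [← Finset.sum_filter, ih]
    cases a <;> simp [zeroEnergy, o1_zero, add_comm]

lemma f2_eq_energy (w : Word) : f2 w = 1 / 2 * (oneEnergy 0 w + zeroEnergy 0 w) := by
  rw [f2, ← sum_zeros_eq_zeroEnergy, ← sum_ones_eq_oneEnergy]
  simp

lemma f2_true_cons (w : Word) : f2 (true :: w) = f2 w := by
  simp [f2_eq_energy, oneEnergy, zeroEnergy]

lemma f2_append_false (w : Word) : f2 (w ++ [false]) = f2 w := by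
  simp [f2_eq_energy, oneEnergy_append, zeroEnergy_append, oneEnergy, zeroEnergy]

lemma f2_pad (w : Word) : f2 (pad w) = f2 w := by
  rw [pad, f2_true_cons, f2_append_false]

lemma f2_dropWhile_true (w : Word) : f2 (w.dropWhile (· = true)) = f2 w := by
  induction w with
  | nil => rfl
  | cons a w ih =>
    cases a
    · simp
    · rw [f2_true_cons, ← ih]; simp

lemma f2_reverse_dropWhile_false (w : Word) :
    f2 (w.dropWhile (· = false)).reverse = f2 w.reverse := by
  induction w with
  | nil => rfl
  | cons a w ih =>
    cases a
    · rw [List.reverse_cons, f2_append_false, ← ih]; simp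
    · simp

lemma f2_strip (w : Word) : f2 (strip w) = f2 w := by
  rw [strip, f2_reverse_dropWhile_false, List.reverse_reverse, f2_dropWhile_true]

/-- Number of `0`s before the cut `c` plus number of `1`s after it. -/
def cutWeight (x : Word) (c : ℕ) : ℕ := (x.take c).count false + (x.drop c).count true

lemma exists_split_pair {x : Word} {i : ℕ} (h : i + 1 < x.length) :
    ∃ u a b v, x = u ++ a :: b :: v ∧ u.length = i := by
  refine ⟨x.take i, x[i], x[i + 1], x.drop (i + 2), ?_, by simp; omega⟩
  rw [List.cons_getElem_drop_succ, List.cons_getElem_drop_succ, List.take_append_drop]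

lemma setPair_append (u v : Word) (a b c d : Bool) :
    setPair (u ++ a :: b :: v) u.length c d = u ++ c :: d :: v := by
  simp [setPair]

lemma cutWeight_append (u v : Word) (a b : Bool) :
    cutWeight (u ++ a :: b :: v) (u.length + 1) =
      (u ++ [a]).count false + (b :: v).count true := by
  have : u ++ a :: b :: v = (u ++ [a]) ++ (b :: v) := by simp
  rw [cutWeight, this, List.take_left' (by simp), List.drop_left' (by simp)]

lemma f2_append_pair (u v : Word) (a b : Bool) :
    f2 (u ++ a :: b :: v) = 1 / 2 *
      (oneEnergy 0 u + oneEnergy (u.count false + [a, b].count false) v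
        + zeroEnergy (v.count true + [a, b].count true) u + zeroEnergy 0 v
        + oneEnergy (u.count false) [a, b] + zeroEnergy (v.count true) [a, b]) := by
  have : u ++ a :: b :: v = u ++ ([a, b] ++ v) := by simp
  rw [f2_eq_energy, this, oneEnergy_append, oneEnergy_append, zeroEnergy_append,
    zeroEnergy_append, List.count_append]
  push_cast
  simp only [zero_add]
  rw [add_comm (([a, b].count true : ℕ) : ℝ)]
  ring

/-- One-step drift of `f2` when the pair `10` is selected. -/
lemma f2_drift_true_false (u v : Word) :
    (f2 (u ++ false :: false :: v) + f2 (u ++ true :: true :: v)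
        - 2 * f2 (u ++ true :: false :: v)
      = cutWeight (u ++ true :: false :: v) (u.length + 1)) ∧
    (f2 (u ++ false :: true :: v) - f2 (u ++ true :: false :: v)
      = cutWeight (u ++ true :: false :: v) (u.length + 1) + 1) := by
  have h1 := oneEnergy_second_difference (u.count false) v
  have h2 := zeroEnergy_second_difference (v.count true) u
  rw [cutWeight_append]
  simp only [f2_append_pair]
  simp [oneEnergy, zeroEnergy]
  constructor <;> linarith

/-- One-step drift of `f2` when the pair `01` is selected. -/
lemma f2_drift_false_true (u v : Word) :
    (f2 (u ++ false :: false :: v) + f2 (u ++ true :: true :: v)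
        - 2 * f2 (u ++ false :: true :: v)
      = -cutWeight (u ++ false :: true :: v) (u.length + 1)) ∧
    (f2 (u ++ true :: false :: v) - f2 (u ++ false :: true :: v)
      = -cutWeight (u ++ false :: true :: v) (u.length + 1) + 1) := by
  have h1 := oneEnergy_second_difference (u.count false) v
  have h2 := zeroEnergy_second_difference (v.count true) u
  rw [cutWeight_append]
  simp only [f2_append_pair]
  simp [oneEnergy, zeroEnergy]
  constructor <;> linarith

/-- Expected value of `f2` after a move of the selected pair `i` of the padded word. -/
noncomputable def pairMean (β p : ℝ) (w : Word) (i : ℕ) : ℝ :=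
  let q := if (pad w).getD i true then 1 - p else p
  β * (1 / 2) * f2 (setPair (pad w) i false false)
    + β * (1 / 2) * f2 (setPair (pad w) i true true)
    + (1 - β) * q * f2 (swapPair (pad w) i) + (1 - β) * (1 - q) * f2 w

lemma hasSum_ite_mul (f : Word → ℝ) (c : ℝ) (a : Word) :
    HasSum (fun w => c * (if a = w then 1 else 0) * f w) (c * f a) := by
  convert hasSum_single (f := fun w => c * (if a = w then 1 else 0) * f w) a ?_ using 1
  · simp
  · intro b hb
    simp [Ne.symm hb]

lemma hasSum_list_sum_mul (l : List ℕ) (h : ℕ → Word → ℝ) (H : ℕ → ℝ) (f : Word → ℝ)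
    (hH : ∀ i, HasSum (fun w => h i w * f w) (H i)) :
    HasSum (fun w => (l.map (fun i => h i w)).sum * f w) (l.map H).sum := by
  induction l with
  | nil => simp
  | cons a l ih => simpa [add_mul] using (hH a).add ih

lemma tsum_P_mul_f2 (β p : ℝ) (w : Word) :
    ∑' w', P β p w w' * f2 w' =
      ((unlike w).map (fun i => ((unlike w).length : ℝ)⁻¹ * pairMean β p w i)).sum := by
  refine (hasSum_list_sum_mul _ _ _ _ fun i => ?_).tsum_eq
  have h (c : ℝ) (a : Word) := hasSum_ite_mul f2 c a
  have := (((h (β * (1 / 2)) (strip (setPair (pad w) i false false))).add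
    (h (β * (1 / 2)) (strip (setPair (pad w) i true true)))).add
    (h ((1 - β) * (if (pad w).getD i true then 1 - p else p)) (strip (swapPair (pad w) i)))).add
    (h ((1 - β) * (1 - (if (pad w).getD i true then 1 - p else p))) w)
  simp only [f2_strip] at this
  refine (this.mul_left ((unlike w).length : ℝ)⁻¹).congr_fun fun w' => ?_
  ring

/-- Indices `i` such that the letters `i` and `i + 1` of the padded word differ. -/
def unlikeSet (w : Word) : Finset ℕ :=
  (Finset.range (w.length + 1)).filter
    (fun i => (pad w).getD i true ≠ (pad w).getD (i + 1) true)

lemma sum_map_unlike (w : Word) (h : ℕ → ℝ) :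
    ((unlike w).map h).sum = ∑ i ∈ unlikeSet w, h i := by
  have hn : (unlike w).Nodup := List.nodup_range.filter _
  rw [← List.sum_toFinset h hn]
  congr 1
  ext i
  simp [unlike, unlikeSet]

lemma length_unlike (w : Word) : (unlike w).length = (unlikeSet w).card := by
  have hn : (unlike w).Nodup := List.nodup_range.filter _
  rw [← List.toFinset_card_of_nodup hn]
  congr 1
  ext i
  simp [unlike, unlikeSet]

/-- `1`, `-1` or `0` according to whether the pair `i` is `10`, `01` or constant. -/
def pairSign (x : Word) (i : ℕ) : ℝ :=
  (if x.getD i true then 1 else 0) - (if x.getD (i + 1) true then 1 else 0)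

lemma length_pad (w : Word) : (pad w).length = w.length + 2 := by simp [pad]

lemma pairMean_sub_le {β p : ℝ} (hβ0 : 0 ≤ β) (hβ : β < 1) (hp : 1 / 2 < p) (hp1 : p ≤ 1)
    {w : Word} {i : ℕ} (hi : i ∈ unlikeSet w) :
    pairMean β p w i - f2 w ≤ 1 / 2 * (pairSign (pad w) i * cutWeight (pad w) (i + 1))
      + (1 - β) * (1 - (p - 1 / 2) * cutWeight (pad w) (i + 1)) := by
  simp only [unlikeSet, Finset.mem_filter, Finset.mem_range] at hi
  obtain ⟨hi, hne⟩ := hi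
  obtain ⟨u, a, b, v, hx, rfl⟩ := exists_split_pair (x := pad w) (i := i)
    (by rw [length_pad]; omega)
  have hf := f2_pad w
  rw [pairMean, pairSign, ← hf]
  rw [hx] at hne ⊢
  simp only [swapPair, setPair_append]
  have ha : (u ++ a :: b :: v).getD u.length true = a := by simp
  have hb : (u ++ a :: b :: v).getD (u.length + 1) true = b := by simp
  rw [ha, hb] at hne ⊢
  have hβ' : 0 ≤ 1 - β := by linarith
  cases a <;> cases b
  · simp at hne
  · obtain ⟨h1, h2⟩ := f2_drift_false_true u v
    simp only [Bool.false_eq_true, if_false, if_true]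
    nlinarith [mul_nonneg hβ' (sub_nonneg.2 hp1)]
  · obtain ⟨h1, h2⟩ := f2_drift_true_false u v
    simp only [Bool.false_eq_true, if_false, if_true]
    nlinarith [mul_nonneg hβ' (by linarith : 0 ≤ p)]
  · simp at hne

lemma count_take_succ {x : Word} {c : ℕ} (h : c < x.length) :
    (x.take (c + 1)).count false =
      (x.take c).count false + if x.getD c true then 0 else 1 := by
  rw [List.take_succ_eq_append_getElem h, List.count_append, List.getD_eq_getElem _ _ h]
  cases x[c] <;> simp

lemma count_drop {x : Word} {c : ℕ} (h : c < x.length) :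
    (x.drop c).count true =
      (x.drop (c + 1)).count true + if x.getD c true then 1 else 0 := by
  rw [List.drop_eq_getElem_cons h, List.getD_eq_getElem _ _ h]
  cases x[c] <;> simp

lemma sum_pairSign_mul_cutWeight (x : Word) (k : ℕ) (hk : k < x.length) :
    ∑ i ∈ Finset.range k, pairSign x i * cutWeight x (i + 1) =
      (if x.getD 0 true then 1 else 0) * (cutWeight x 1 : ℝ) + (x.drop (k + 1)).count true
        - (x.drop 1).count true - (if x.getD k true then 1 else 0) * (cutWeight x (k + 1) : ℝ) := by
  induction k with
  | zero => simp
  | succ k ih =>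
    have hd := count_drop hk
    have hs : (cutWeight x (k + 2) : ℝ) =
        cutWeight x (k + 1) + 1 - 2 * (if x.getD (k + 1) true then 1 else 0) := by
      rw [cutWeight, cutWeight, count_take_succ hk, hd]
      push_cast
      split_ifs <;> ring
    rw [Finset.sum_range_succ, ih (by omega), hd, pairSign, hs]
    push_cast
    split_ifs <;> ring

lemma sum_unlike_pairSign (w : Word) :
    ∑ i ∈ unlikeSet w, pairSign (pad w) i * cutWeight (pad w) (i + 1) = 0 := by
  rw [unlikeSet, Finset.sum_filter_of_ne,
    sum_pairSign_mul_cutWeight _ _ (by rw [length_pad]; omega)]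
  · simp [cutWeight, pad]
  · intro i _ h he
    apply h
    simp only [pairSign, he, sub_self, zero_mul]

lemma card_unlike_left (x : Word) (c : ℕ) (hc : c < x.length) :
    ((Finset.range c).filter (fun i => x.getD i true ≠ x.getD (i + 1) true)).card
      + (if x.getD c true then 0 else 1) ≤ 2 * (x.take (c + 1)).count false := by
  induction c with
  | zero =>
    rw [count_take_succ hc]
    split_ifs <;> simp
  | succ c ih =>
    have := ih (by omega)
    rw [count_take_succ hc, Finset.card_filter, Finset.sum_range_succ, ← Finset.card_filter]
    cases h1 : x.getD c true <;> cases h2 : x.getD (c + 1) true <;> simp_all <;> omega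

lemma card_unlike_right (x : Word) (c d : ℕ) (hd : c + d < x.length) :
    ((Finset.Ico c (c + d)).filter (fun i => x.getD i true ≠ x.getD (i + 1) true)).card
      + (if x.getD c true then 1 else 0) ≤ 2 * (x.drop c).count true := by
  induction d generalizing c with
  | zero =>
    rw [count_drop (by omega)]
    split_ifs <;> simp; omega
  | succ d ih =>
    have := ih (c + 1) (by omega)
    rw [count_drop (by omega), Finset.card_filter, Finset.sum_eq_sum_Ico_succ_bot (by omega),
      ← Finset.card_filter]
    rw [show c + 1 + d = c + (d + 1) by ring] at this
    cases h1 : x.getD c true <;> cases h2 : x.getD (c + 1) true <;> simp_all <;> omega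

lemma card_unlikeSet_le (w : Word) {i : ℕ} (hi : i ∈ unlikeSet w) :
    (unlikeSet w).card ≤ 2 * cutWeight (pad w) (i + 1) + 1 := by
  have hi' : i < w.length + 1 := by
    simp only [unlikeSet, Finset.mem_filter, Finset.mem_range] at hi
    exact hi.1
  have h1 := card_unlike_left (pad w) i (by rw [length_pad]; omega)
  have h2 := card_unlike_right (pad w) (i + 1) (w.length - i) (by rw [length_pad]; omega)
  rw [show i + 1 + (w.length - i) = w.length + 1 by omega] at h2
  have h3 : (unlikeSet w).card =
      ((Finset.range i).filter (fun i => (pad w).getD i true ≠ (pad w).getD (i + 1) true)).card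
      + 1 + ((Finset.Ico (i + 1) (w.length + 1)).filter
        (fun i => (pad w).getD i true ≠ (pad w).getD (i + 1) true)).card := by
    have hne := (Finset.mem_filter.1 hi).2
    rw [unlikeSet, Finset.card_filter, Finset.card_filter, Finset.card_filter,
      ← Finset.sum_range_add_sum_Ico _ hi', Finset.sum_range_succ, if_pos hne]
  rw [cutWeight]
  omega

lemma length_le_sum_cutWeight {w : Word} (hw : IsConfig w) (hne : w ≠ []) :
    2 ≤ (unlikeSet w).card ∧
      w.length ≤ ∑ i ∈ unlikeSet w, cutWeight (pad w) (i + 1) := by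
  obtain ⟨hh, hl⟩ := hw.resolve_left hne
  have hpos : 0 < w.length := List.length_pos_iff.2 hne
  have h0 : 0 ∈ unlikeSet w := by
    cases w with
    | nil => simp at hne
    | cons a w => simp_all [unlikeSet, pad]
  have hL : w.length ∈ unlikeSet w := by
    obtain ⟨v, rfl⟩ : ∃ v, w = v ++ [true] := by
      rcases List.eq_nil_or_concat w with h | ⟨v, b, rfl⟩
      · exact absurd h hne
      · simp at hl; exact ⟨v, by simp [hl]⟩
    simp [unlikeSet, pad]
  have hsub : ({0, w.length} : Finset ℕ) ⊆ unlikeSet w := by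
    intro j hj
    simp at hj
    rcases hj with rfl | rfl <;> assumption
  refine ⟨?_, ?_⟩
  · rw [← Finset.card_pair hpos.ne]
    exact Finset.card_le_card hsub
  · refine le_trans ?_ (Finset.sum_le_sum_of_subset hsub)
    rw [Finset.sum_pair hpos.ne]
    simp [cutWeight, pad]

lemma f2_le_length_pow (w : Word) : f2 w ≤ (w.length : ℝ) ^ 3 := by
  have hz (b : ℕ) (hb : b < w.length) : z0 w b ≤ w.length :=
    (Finset.card_filter_le _ _).trans (by simpa using hb.le)
  have ho (c : ℕ) : o1 w c ≤ w.length := (Finset.card_filter_le _ _).trans (by simp)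
  have key (s : Finset ℕ) (hs : s ⊆ Finset.range w.length) (g : ℕ → ℕ)
      (hg : ∀ b ∈ s, g b ≤ w.length) : ∑ b ∈ s, (g b : ℝ) ^ 2 ≤ (w.length : ℝ) ^ 3 := by
    have hc : s.card ≤ w.length := by simpa using Finset.card_le_card hs
    calc ∑ b ∈ s, (g b : ℝ) ^ 2 ≤ ∑ _b ∈ s, (w.length : ℝ) ^ 2 := by
          refine Finset.sum_le_sum fun b hb => ?_
          have : (g b : ℝ) ≤ w.length := by exact_mod_cast hg b hb
          gcongr
      _ = s.card * (w.length : ℝ) ^ 2 := by simp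
      _ ≤ w.length * (w.length : ℝ) ^ 2 := by gcongr
      _ = (w.length : ℝ) ^ 3 := by ring
  have h1 := key _ (Finset.filter_subset (fun b => w.getD b false = true) _) (z0 w)
    fun b hb => hz b (by simpa using (Finset.mem_filter.1 hb).1)
  have h2 := key _ (Finset.filter_subset (fun a => w.getD a true = false) _)
    (fun a => o1 w (a + 1)) fun b _ => ho _
  rw [f2]
  linarith

lemma f2_nonneg (w : Word) : 0 ≤ f2 w := by
  unfold f2
  positivity

lemma f2_rpow_le_sqrt_length (w : Word) : f2 w ^ ((1 : ℝ) / 6) ≤ √(w.length : ℝ) := by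
  calc f2 w ^ ((1 : ℝ) / 6) ≤ ((w.length : ℝ) ^ 3) ^ ((1 : ℝ) / 6) :=
        Real.rpow_le_rpow (f2_nonneg w) (f2_le_length_pow w) (by norm_num)
    _ = √(w.length : ℝ) := by
        rw [← Real.rpow_natCast, ← Real.rpow_mul (by positivity), Real.sqrt_eq_rpow]
        norm_num

/-- The drift is at most `-(1 - β)((p - 1/2)√|S|/2 - 1)`. -/
lemma f2_drift_le_sqrt_length {β p : ℝ} (hβ0 : 0 ≤ β) (hβ : β < 1) (hp : 1 / 2 < p)
    (hp1 : p ≤ 1) {w : Word} (hw : IsConfig w) (hne : w ≠ []) :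
    (∑' w', P β p w w' * f2 w') - f2 w ≤
      (1 - β) * (1 - (p - 1 / 2) * (√(w.length : ℝ) / 2)) := by
  obtain ⟨hn, hL⟩ := length_le_sum_cutWeight hw hne
  have hX : (unlikeSet w).card * (unlikeSet w).card ≤
      ∑ i ∈ unlikeSet w, (2 * cutWeight (pad w) (i + 1) + 1) := by
    rw [← smul_eq_mul]
    exact Finset.card_nsmul_le_sum _ _ _ fun i hi => card_unlikeSet_le w hi
  rw [Finset.sum_add_distrib, ← Finset.mul_sum, Finset.sum_const, smul_eq_mul, mul_one] at hX
  set X := ∑ i ∈ unlikeSet w, cutWeight (pad w) (i + 1) with hXdef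
  set n := (unlikeSet w).card with hndef
  have hn0 : (0 : ℝ) < n := by exact_mod_cast (by omega : 0 < n)
  have hdrift : (∑' w', P β p w w' * f2 w') - f2 w =
      (n : ℝ)⁻¹ * ∑ i ∈ unlikeSet w, (pairMean β p w i - f2 w) := by
    rw [tsum_P_mul_f2, sum_map_unlike, length_unlike, ← Finset.mul_sum, Finset.sum_sub_distrib,
      Finset.sum_const, ← hndef, nsmul_eq_mul]
    field_simp
  have hsum : ∑ i ∈ unlikeSet w, (pairMean β p w i - f2 w) ≤
      (1 - β) * (n - (p - 1 / 2) * X) := by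
    refine (Finset.sum_le_sum fun i hi => pairMean_sub_le hβ0 hβ hp hp1 hi).trans_eq ?_
    rw [Finset.sum_add_distrib, ← Finset.mul_sum, sum_unlike_pairSign, ← Finset.mul_sum,
      Finset.sum_sub_distrib, ← Finset.mul_sum, hXdef, hndef]
    simp
  have hsqrt : n * (√(w.length : ℝ) / 2) ≤ X := by
    have h1 : (w.length : ℝ) ≤ X := by exact_mod_cast hL
    have h2 : (n : ℝ) * n ≤ 2 * X + n := by exact_mod_cast hX
    have h3 : (2 : ℝ) ≤ n := by exact_mod_cast hn
    have h4 : (n : ℝ) ^ 2 ≤ 4 * X := by nlinarith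
    refine abs_le_of_sq_le_sq' ?_ (by positivity) |>.2
    rw [mul_pow, div_pow, Real.sq_sqrt (by positivity)]
    nlinarith [mul_le_mul h4 h1 (by positivity) (by positivity)]
  rw [hdrift, inv_mul_le_iff₀ hn0]
  refine hsum.trans ?_
  have h5 := mul_le_mul_of_nonneg_left hsqrt
    (mul_nonneg (by linarith : 0 ≤ 1 - β) (by linarith : 0 ≤ p - 1 / 2))
  nlinarith

/-- Lemma 12 (drift of `f₂`): if `β ∈ [0,1)` and `p > 1/2`, then there is `C ∈ (0,∞)`
such that for all but finitely many `S ∈ 𝒟`,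
`Σ_{S'} P(S,S') f₂(S') − f₂(S) ≤ −C f₂(S)^{1/6}`. -/
theorem f2_drift_bound
    (β : ℝ) (hβ0 : 0 ≤ β) (hβ : β < 1)
    (p : ℝ) (hp : 1 / 2 < p) (hp1 : p ≤ 1) :
    ∃ C : ℝ, 0 < C ∧ ∃ F : Finset Word,
      ∀ S : Word, IsConfig S → S ∉ F →
        (∑' S' : Word, P β p S S' * f2 S') - f2 S ≤ -C * f2 S ^ ((1 : ℝ) / 6) := by
  have hr : 0 < p - 1 / 2 := by linarith
  have hb : 0 < 1 - β := by linarith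
  refine ⟨(1 - β) * (p - 1 / 2) / 4, by positivity, ?_⟩
  obtain ⟨M, hM⟩ := exists_nat_ge ((4 / (p - 1 / 2)) ^ 2)
  refine ⟨(List.finite_length_lt Bool (M + 1)).toFinset, fun S hS hSF => ?_⟩
  have hlen : M + 1 ≤ S.length := by simpa using hSF
  have hne : S ≠ [] := by
    rintro rfl
    simp at hlen
  refine (f2_drift_le_sqrt_length hβ0 hβ hp hp1 hS hne).trans ?_
  have hsq : 4 / (p - 1 / 2) ≤ √(S.length : ℝ) := by
    refine Real.le_sqrt_of_sq_le (hM.trans ?_)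
    exact_mod_cast (by omega : M ≤ S.length)
  rw [div_le_iff₀ hr] at hsq
  have hf := mul_le_mul_of_nonneg_left (f2_rpow_le_sqrt_length S)
    (by positivity : 0 ≤ (1 - β) * (p - 1 / 2) / 4)
  have := mul_le_mul_of_nonneg_left hsq hb.le
  nlinarith

end EV
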